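/- arXiv:1412.5544 — 2 statements merged into one kernel-verified Lean document; each statement's English description precedes it below -/
import Mathlib

section
/- The center of a nil-clean ring is nil-clean. -/
/-- A ring is nil-clean if every element is a sum of a nilpotent and an idempotent. -/
def IsNilClean (R : Type*) [Ring R] : Prop :=
  ∀ a : R, ∃ b e : R, IsNilpotent b ∧ IsIdempotentElem e ∧ a = b + e

theorem lift_idem_aux {Z : Type*} [CommRing Z] (c : Z) (hc : IsNilpotent (c * c - c)) :
    ∃ b e : Z, IsNilpotent b ∧ IsIdempotentElem e ∧ c = b + e := by
  obtain ⟨e, he, hfe⟩ := exists_isIdempotentElem_eq_of_ker_isNilpotent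
    (Ideal.Quotient.mk (nilradical Z))
    (fun x hx => by rwa [Ideal.mk_ker, mem_nilradical] at hx)
    (Ideal.Quotient.mk (nilradical Z) c) ⟨c, rfl⟩
    (by
      show _ * _ = _
      rw [← map_mul]
      exact Ideal.Quotient.eq.2 (mem_nilradical.2 hc))
  exact ⟨c - e, e, mem_nilradical.1 (Ideal.Quotient.eq.1 hfe.symm), he, by ring⟩

theorem center_nilClean {R : Type*} [Ring R] (h : IsNilClean R) :
    IsNilClean (Subring.center R) := by
  intro c
  apply lift_idem_aux c
  obtain ⟨b, e, ⟨n, hb⟩, he, hce⟩ := h c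
  have hcen : e * (c : R) = c * e := Subring.mem_center_iff.1 c.2 e
  have hcomm : e * b = b * e := by
    rw [hce, mul_add, add_mul] at hcen
    exact add_right_cancel hcen
  have key : (c : R) * c - c = b * (b + 2 * e - 1) := by
    rw [hce]
    have : e * e = e := he
    simp only [mul_add, add_mul, mul_sub, two_mul, this, hcomm, mul_one]
    abel
  have hC : Commute b (b + 2 * e - 1) := by
    have h1 : Commute b e := hcomm.symm
    exact (((Commute.refl b).add_right ((Commute.ofNat_right b 2).mul_right h1)).sub_right
      (Commute.one_right b))
  refine ⟨n, Subtype.ext ?_⟩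
  push_cast
  rw [key, hC.mul_pow, hb, zero_mul]
end

section
/- If R is an abelian weakly nil-clean ring, then J(R) is nil and R/J(R) is isomorphic to a Boolean ring, or to ℤ/3ℤ, or to a direct product of a Boolean ring and ℤ/3ℤ. -/
/-- A ring is weakly nil-clean if every element is a sum or a difference of a
nilpotent and an idempotent. -/
def IsWeaklyNilClean (R : Type*) [Ring R] : Prop :=
  ∀ a : R, ∃ b e : R, IsNilpotent b ∧ IsIdempotentElem e ∧ (a = b + e ∨ a = b - e)

universe u

lemma wnc_comm_struct {Q : Type u} [CommRing Q]
    (hq : ∀ a : Q, a * a = a ∨ a * a = -a) :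
    ∃ (B : Type u) (_ : BooleanRing B),
        Nonempty (Q ≃+* B) ∨ Nonempty (Q ≃+* ZMod 3) ∨ Nonempty (Q ≃+* B × ZMod 3) := by
  have bool_of : ∀ {A : Type u} [CommRing A], (2 : A) = 0 →
      (∀ a : A, a * a = a ∨ a * a = -a) → ∀ a : A, a * a = a := by
    intro A _ h2 hA a
    rcases hA a with h | h
    · exact h
    · rw [h]; linear_combination (-a) * h2
  by_cases h2 : (2 : Q) = 0
  · exact ⟨Q, { (inferInstance : CommRing Q) with isIdempotentElem := bool_of h2 hq },
      Or.inl ⟨RingEquiv.refl Q⟩⟩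
  have h6 : (6 : Q) = 0 := by
    rcases hq 2 with h | h
    · exact absurd (by linear_combination h) h2
    · linear_combination h
  let I : Ideal Q := Ideal.span {2}
  let K : Ideal Q := Ideal.span {3}
  have hcop : IsCoprime I K := by
    rw [Ideal.isCoprime_span_singleton_iff]
    exact ⟨-1, 1, by ring⟩
  have hIK : I * K = ⊥ := by
    rw [Ideal.span_singleton_mul_span_singleton]
    have : (2 : Q) * 3 = 0 := by linear_combination h6
    rw [this]; simp
  have hquot : ∀ L : Ideal Q, ∀ a : Q ⧸ L, a * a = a ∨ a * a = -a := by
    intro L a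
    obtain ⟨a, rfl⟩ := Ideal.Quotient.mk_surjective a
    rcases hq a with h | h
    · left; rw [← map_mul, h]
    · right; rw [← map_mul, h, map_neg]
  have hI2 : (2 : Q ⧸ I) = 0 := by
    have := Ideal.Quotient.eq_zero_iff_mem.mpr (Ideal.mem_span_singleton_self (2 : Q))
    rwa [map_ofNat] at this
  have hK3 : (3 : Q ⧸ K) = 0 := by
    have := Ideal.Quotient.eq_zero_iff_mem.mpr (Ideal.mem_span_singleton_self (3 : Q))
    rwa [map_ofNat] at this
  have hnt : Nontrivial (Q ⧸ K) := by
    rw [Ideal.Quotient.nontrivial_iff, Ne, Ideal.span_singleton_eq_top]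
    intro hu
    obtain ⟨v, hv⟩ := hu.exists_right_inv
    exact h2 (by linear_combination (-2) * hv + v * h6)
  have hchar : CharP (Q ⧸ K) 3 := by
    have := CharP.ringChar_of_prime_eq_zero (R := Q ⧸ K) Nat.prime_three (by exact_mod_cast hK3)
    exact ringChar.of_eq this
  have hbij : Function.Bijective (ZMod.castHom (dvd_refl 3) (Q ⧸ K)) := by
    refine ⟨RingHom.injective _, fun a => ?_⟩
    have key : ∀ e : Q ⧸ K, e * e = e → e = 0 ∨ e = 1 := by
      intro e he
      rcases hquot K (2 * e - 1) with h | h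
      · right; linear_combination h - 4 * he + (e - 1) * hK3
      · left; linear_combination 4 * he - h + e * hK3
    have key2 : a = 0 ∨ a = 1 ∨ a = -1 := by
      rcases hquot K a with h | h
      · rcases key a h with h | h <;> simp [h]
      · rcases key (-a) (by rw [neg_mul_neg, h]) with h | h
        · left; simpa using h
        · right; right; rw [← h, neg_neg]
    rcases key2 with rfl | rfl | rfl
    · exact ⟨0, map_zero _⟩
    · exact ⟨1, map_one _⟩
    · exact ⟨-1, by rw [map_neg, map_one]⟩
  refine ⟨Q ⧸ I, { (inferInstance : CommRing (Q ⧸ I)) with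
    isIdempotentElem := bool_of hI2 (hquot I) }, Or.inr (Or.inr ⟨?_⟩)⟩
  exact ((RingEquiv.quotientBot Q).symm.trans (Ideal.quotEquivOfEq hIK.symm)).trans
    ((Ideal.quotientMulEquivQuotientProd I K hcop).trans
      (RingEquiv.prodCongr (RingEquiv.refl _) (RingEquiv.ofBijective _ hbij).symm))

lemma wnc_ring_struct {Q : Type u} [Ring Q] (hc : ∀ a b : Q, a * b = b * a)
    (hq : ∀ a : Q, a * a = a ∨ a * a = -a) :
    ∃ (B : Type u) (_ : BooleanRing B),
        Nonempty (Q ≃+* B) ∨ Nonempty (Q ≃+* ZMod 3) ∨ Nonempty (Q ≃+* B × ZMod 3) := by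
  let _ : CommRing Q := { (inferInstance : Ring Q) with mul_comm := hc }
  exact wnc_comm_struct hq

/-- An idempotent that is central and a left multiple of a nilpotent vanishes. -/
lemma wnc_idem_zero {R : Type u} [Ring R] {e w b : R} (he : e * e = e)
    (hc : ∀ x, e * x = x * e) (hb : IsNilpotent b) (h : e = w * b) : e = 0 := by
  obtain ⟨n, hn⟩ := hb
  have : ∀ k : ℕ, e = w ^ k * e * b ^ k := by
    intro k
    induction k with
    | zero => simp
    | succ k ih =>
      have h1 : e = w * e * b := by
        rw [mul_assoc, hc b, ← mul_assoc, ← h, he]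
      calc e = w ^ k * e * b ^ k := ih
        _ = w ^ k * (w * e * b) * b ^ k := by rw [← h1]
        _ = _ := by rw [pow_succ w, pow_succ' b]; simp only [mul_assoc]
  rw [this n, hn, mul_zero]

/-- If `x = b ± e` with `e` central idempotent, then `e` is a left multiple of `x`. -/
lemma wnc_left_mult {R : Type u} [Ring R] {x b e : R} (he : e * e = e)
    (hc : ∀ x, e * x = x * e) (hb : IsNilpotent b) (h : x = b + e ∨ x = b - e) :
    ∃ u, e = u * x := by
  rcases h with h | h
  · obtain ⟨v, hv⟩ := hb.isUnit_add_one.exists_left_inv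
    refine ⟨e * v, ?_⟩
    have h1 : e * x = e * (b + 1) := by rw [h, mul_add, mul_add, he, mul_one]
    rw [hc v, mul_assoc, h1, ← mul_assoc, ← hc v, mul_assoc, hv, mul_one]
  · obtain ⟨v, hv⟩ := hb.isUnit_sub_one.exists_left_inv
    refine ⟨e * v, ?_⟩
    have h1 : e * x = e * (b - 1) := by rw [h, mul_sub, mul_sub, he, mul_one]
    rw [hc v, mul_assoc, h1, ← mul_assoc, ← hc v, mul_assoc, hv, mul_one]

theorem abelian_weaklyNilClean_structure {R : Type u} [Ring R]
    (hab : ∀ e : R, IsIdempotentElem e → e ∈ Set.center R)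
    (h : IsWeaklyNilClean R) :
    (∀ x ∈ (⊥ : TwoSidedIdeal R).jacobson, IsNilpotent x) ∧
      ∃ (B : Type u) (_ : BooleanRing B),
        Nonempty ((⊥ : TwoSidedIdeal R).jacobson.ringCon.Quotient ≃+* B) ∨
        Nonempty ((⊥ : TwoSidedIdeal R).jacobson.ringCon.Quotient ≃+* ZMod 3) ∨
        Nonempty ((⊥ : TwoSidedIdeal R).jacobson.ringCon.Quotient ≃+* B × ZMod 3) := by
  have hcen : ∀ e : R, e * e = e → ∀ x, e * x = x * e := fun e he x =>
    ((Set.mem_center_iff.mp (hab e he)).comm x).eq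
  have hnilJ : ∀ b : R, IsNilpotent b → b ∈ (⊥ : TwoSidedIdeal R).jacobson := by
    intro b hb
    rw [TwoSidedIdeal.mem_jacobson_iff]
    intro y
    obtain ⟨n, e, hn, he, hx⟩ := h (y * b)
    obtain ⟨w, hw⟩ := wnc_left_mult he (hcen e he) hn hx
    have he0 : e = 0 := wnc_idem_zero (w := w * y) he (hcen e he) hb (by rw [hw, mul_assoc])
    have hyb : IsNilpotent (y * b) := by
      rcases hx with hx | hx <;> simpa [hx, he0] using hn
    obtain ⟨v, hv⟩ := hyb.isUnit_add_one.exists_left_inv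
    refine ⟨v, ?_⟩
    rw [TwoSidedIdeal.mem_bot, ← hv]
    noncomm_ring
  have hJidem : ∀ e : R, e * e = e → e ∈ (⊥ : TwoSidedIdeal R).jacobson → e = 0 := by
    intro e he hJ
    rw [TwoSidedIdeal.mem_jacobson_iff] at hJ
    obtain ⟨z, hz⟩ := hJ (-1)
    rw [TwoSidedIdeal.mem_bot, sub_eq_zero] at hz
    calc e = (z * -1 * e + z) * e := by rw [hz, one_mul]
      _ = z * (e - e * e) := by noncomm_ring
      _ = 0 := by rw [he, sub_self, mul_zero]
  refine ⟨?_, ?_⟩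
  · intro x hx
    obtain ⟨n, e, hn, he, hxe⟩ := h x
    obtain ⟨w, hw⟩ := wnc_left_mult he (hcen e he) hn hxe
    have he0 : e = 0 := hJidem e he (by rw [hw]; exact TwoSidedIdeal.mul_mem_left _ _ _ hx)
    rcases hxe with hx | hx <;> simpa [hx, he0] using hn
  · set J := (⊥ : TwoSidedIdeal R).jacobson with hJdef
    have hrep : ∀ q : J.ringCon.Quotient, ∃ e : R, e * e = e ∧
        (q = J.ringCon.mk' e ∨ q = - J.ringCon.mk' e) := by
      intro q
      obtain ⟨a, rfl⟩ := RingCon.mk'_surjective J.ringCon q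
      obtain ⟨n, e, hn, he, hx⟩ := h a
      have hn0 : J.ringCon.mk' n = 0 := by
        rw [← map_zero J.ringCon.mk']
        exact (RingCon.eq _).mpr ((TwoSidedIdeal.mem_iff _ _).mp (hnilJ n hn))
      refine ⟨e, he, ?_⟩
      rcases hx with hx | hx
      · left; rw [hx, map_add, hn0, zero_add]
      · right; rw [hx, map_sub, hn0, zero_sub]
    apply wnc_ring_struct
    · intro p q
      obtain ⟨e, he, hp⟩ := hrep p
      obtain ⟨a, rfl⟩ := RingCon.mk'_surjective J.ringCon q
      have : J.ringCon.mk' e * J.ringCon.mk' a = J.ringCon.mk' a * J.ringCon.mk' e := by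
        rw [← map_mul, hcen e he, map_mul]
      rcases hp with rfl | rfl
      · exact this
      · rw [neg_mul, mul_neg, this]
    · intro q
      obtain ⟨e, he, hp⟩ := hrep q
      have h1 : J.ringCon.mk' e * J.ringCon.mk' e = J.ringCon.mk' e := by rw [← map_mul, he]
      rcases hp with rfl | rfl
      · left; exact h1
      · right; rw [neg_mul_neg, h1, neg_neg]
end
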